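/- For every integer p ≥ 2, every N ∈ ℕ, α > 0, β > 0 and t ∈ [0,1], with γ = α^{p−1}, the p-spin cavity function is differentiable in t and ∂Ψ_N(α,β,t)/∂t = 2α^{p−1} ln cosh β − 2α^{p−1} ∑_{n=1}^∞ ((−1)^n/n) θ^n ⟨q_{1…n}^{p−1}⟩_{N,t}, where θ = tanh β and the series converges absolutely. -/

import Mathlib

open scoped BigOperators

noncomputable section

/-- The Poisson probability mass function with mean `lam`. -/
def pois (lam : ℝ) (k : ℕ) : ℝ := Real.exp (-lam) * lam ^ k / (Nat.factorial k)

/-- The spin value (±1) attached to a Boolean opinion. -/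
def spin (b : Bool) : ℝ := if b then 1 else -1

/-- Average of `f` over `p` families of `k` i.i.d. indices, each uniform on `Fin N`. -/
def avgIdx (N : ℕ) (p k : ℕ) (f : (Fin p → Fin k → Fin N) → ℝ) : ℝ :=
  ((N : ℝ) ^ (p * k))⁻¹ * ∑ im : Fin p → Fin k → Fin N, f im

/-- The interaction sum `∑_{ν=1}^k σ_{i_ν^1} ⋯ σ_{i_ν^p}`; the Hamiltonian is its negative. -/
def intSum {N p k : ℕ} (im : Fin p → Fin k → Fin N) (σ : Fin N → Bool) : ℝ :=
  ∑ ν : Fin k, ∏ l : Fin p, spin (σ (im l ν))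

/-- The diluted `p`-spin Hamiltonian `H = -∑_{ν=1}^k σ_{i_ν^1} ⋯ σ_{i_ν^p}`. -/
def Hspin {N p k : ℕ} (im : Fin p → Fin k → Fin N) (σ : Fin N → Bool) : ℝ :=
  - intSum im σ

/-- Partition function `Z = ∑_σ e^{-β H(σ)}`. -/
def Zpart (β : ℝ) {N p k : ℕ} (im : Fin p → Fin k → Fin N) : ℝ :=
  ∑ σ : Fin N → Bool, Real.exp (β * intSum im σ)

/-- Cavity term `∑_{ν=1}^{k'} σ_{i_ν^1} ⋯ σ_{i_ν^q}` (with `q = p - 1` families). -/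
def cavSum {N q k' : ℕ} (im' : Fin q → Fin k' → Fin N) (σ : Fin N → Bool) : ℝ :=
  ∑ ν : Fin k', ∏ l : Fin q, spin (σ (im' l ν))

/-- Perturbed Boltzmann weight `exp(β(∑_ν σ_{i_ν^1}⋯σ_{i_ν^p} + ∑_ν σ_{i'_ν^1}⋯σ_{i'_ν^{q}}))`. -/
def wpert (β : ℝ) {N p k q k' : ℕ} (im : Fin p → Fin k → Fin N)
    (im' : Fin q → Fin k' → Fin N) (σ : Fin N → Bool) : ℝ :=
  Real.exp (β * (intSum im σ + cavSum im' σ))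

/-- Perturbed partition function. -/
def Zpert (β : ℝ) {N p k q k' : ℕ} (im : Fin p → Fin k → Fin N)
    (im' : Fin q → Fin k' → Fin N) : ℝ :=
  ∑ σ : Fin N → Bool, wpert β im im' σ

/-- Replicated (unperturbed) Boltzmann state `Ω(g)` on `s` replicas sharing the same disorder. -/
def OmegaB (β : ℝ) {N p k : ℕ} (im : Fin p → Fin k → Fin N)
    (s : ℕ) (g : (Fin s → Fin N → Bool) → ℝ) : ℝ :=
  (∑ σs : Fin s → Fin N → Bool, g σs * ∏ a : Fin s, Real.exp (β * intSum im (σs a))) /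
    (Zpart β im) ^ s

/-- Replicated perturbed Boltzmann state `Ω̃_t(g)` on `s` replicas sharing the same disorder. -/
def OmegaPert (β : ℝ) {N p k q k' : ℕ} (im : Fin p → Fin k → Fin N)
    (im' : Fin q → Fin k' → Fin N) (s : ℕ) (g : (Fin s → Fin N → Bool) → ℝ) : ℝ :=
  (∑ σs : Fin s → Fin N → Bool, g σs * ∏ a : Fin s, wpert β im im' (σs a)) /
    (Zpert β im im') ^ s

/-- Quenched expectation: the number of interaction terms is Poisson of mean `γ N` and the
`p` index families are i.i.d. uniform on `Fin N`. -/
def Equench (N p : ℕ) (γ : ℝ) (f : (k : ℕ) → (Fin p → Fin k → Fin N) → ℝ) : ℝ :=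
  ∑' k : ℕ, pois (γ * N) k * avgIdx N p k (fun im => f k im)

/-- Quenched expectation including the cavity randomness: the cavity term has a Poisson
number of terms of mean `2 γ t`, with `p - 1` independent uniform index families. -/
def EquenchCav (N p : ℕ) (γ t : ℝ)
    (f : (k : ℕ) → (Fin p → Fin k → Fin N) →
         (k' : ℕ) → (Fin (p - 1) → Fin k' → Fin N) → ℝ) : ℝ :=
  ∑' k : ℕ, pois (γ * N) k * avgIdx N p k (fun im =>
    ∑' k' : ℕ, pois (2 * γ * t) k' * avgIdx N (p - 1) k' (fun im' => f k im k' im'))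

/-- Quenched average of `ln Z_N`. -/
def ElnZ (N p : ℕ) (γ β : ℝ) : ℝ :=
  Equench N p γ (fun _ im => Real.log (Zpart β im))

/-- Quenched pressure `A_N = (1/N) E[ln Z_N]`. -/
def pressure (N p : ℕ) (γ β : ℝ) : ℝ :=
  (N : ℝ)⁻¹ * ElnZ N p γ β

/-- Cavity function `Ψ_N(t) = E[ln (Z_{N,t} / Z_N)]`. -/
def cavityFn (N p : ℕ) (γ β t : ℝ) : ℝ :=
  EquenchCav N p γ t (fun _ im _ im' => Real.log (Zpert β im im' / Zpart β im))

/-- The multi-overlap `q_{1…n} = (1/N) ∑_i σ_i^{(1)} ⋯ σ_i^{(n)}` of `n` replicas. -/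
def qOv (N n : ℕ) (σs : Fin n → Fin N → Bool) : ℝ :=
  (N : ℝ)⁻¹ * ∑ x : Fin N, ∏ a : Fin n, spin (σs a x)

/-- Total (quenched) average `⟨q_{1…n}^r⟩_N` of the `r`-th power of the `n`-replica overlap. -/
def qPowAvg (N p : ℕ) (γ β : ℝ) (n r : ℕ) : ℝ :=
  Equench N p γ (fun _ im => OmegaB β im n (fun σs => (qOv N n σs) ^ r))

/-- Perturbed total average `⟨q_{1…n}^r⟩_{N,t}` of the `r`-th power of the `n`-replica overlap. -/
def qPowAvgPert (N p : ℕ) (γ β t : ℝ) (n r : ℕ) : ℝ :=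
  EquenchCav N p γ t (fun _ im _ im' => OmegaPert β im im' n (fun σs => (qOv N n σs) ^ r))

end

/-- The expectation of `a` under the (signed, when `x < 0`) Poisson weights of mean `x`. -/
noncomputable def poisAvg (x : ℝ) (a : ℕ → ℝ) : ℝ := ∑' k : ℕ, pois x k * a k

lemma hasSum_pow_div_factorial (x : ℝ) :
    HasSum (fun k : ℕ => x ^ k / (k.factorial : ℝ)) (Real.exp x) := by
  rw [Real.exp_eq_exp_ℝ]
  exact NormedSpace.expSeries_div_hasSum_exp x

lemma hasSum_pois (x : ℝ) : HasSum (pois x) 1 := by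
  have h := (hasSum_pow_div_factorial x).mul_left (Real.exp (-x))
  rw [← Real.exp_add, neg_add_cancel, Real.exp_zero] at h
  exact h.congr_fun fun k => by rw [pois, mul_div_assoc]

lemma hasSum_abs_pois (x : ℝ) :
    HasSum (fun k => |pois x k|) (Real.exp (-x) * Real.exp |x|) :=
  ((hasSum_pow_div_factorial |x|).mul_left (Real.exp (-x))).congr_fun fun k => by
    rw [pois, mul_div_assoc, abs_mul, abs_div, abs_pow, Real.abs_exp, Nat.abs_cast]

lemma summable_pois_mul (x : ℝ) {a : ℕ → ℝ} {B : ℝ} (ha : ∀ k, |a k| ≤ B) :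
    Summable fun k => pois x k * a k := by
  refine Summable.of_norm_bounded ((hasSum_abs_pois x).summable.mul_right B) fun k => ?_
  rw [Real.norm_eq_abs, abs_mul]
  exact mul_le_mul_of_nonneg_left (ha k) (abs_nonneg _)

lemma poisAvg_const (x c : ℝ) : poisAvg x (fun _ => c) = c := by
  rw [poisAvg, tsum_mul_right, (hasSum_pois x).tsum_eq, one_mul]

lemma poisAvg_const_mul (x c : ℝ) (a : ℕ → ℝ) :
    poisAvg x (fun k => c * a k) = c * poisAvg x a := by
  simp only [poisAvg, ← tsum_mul_left]
  exact tsum_congr fun k => by ring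

lemma poisAvg_const_sub (x c : ℝ) {a : ℕ → ℝ} {B : ℝ} (ha : ∀ k, |a k| ≤ B) :
    poisAvg x (fun k => c - a k) = c - poisAvg x a := by
  have h := ((hasSum_pois x).mul_right c).sub (summable_pois_mul x ha).hasSum
  rw [one_mul] at h
  simpa only [poisAvg, mul_sub] using h.tsum_eq

lemma abs_poisAvg_le' (x : ℝ) {a : ℕ → ℝ} {B : ℝ} (ha : ∀ k, |a k| ≤ B) :
    |poisAvg x a| ≤ Real.exp (-x) * Real.exp |x| * B := by
  rw [← Real.norm_eq_abs]
  refine tsum_of_norm_bounded ((hasSum_abs_pois x).mul_right B) fun k => ?_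
  rw [Real.norm_eq_abs, abs_mul]
  exact mul_le_mul_of_nonneg_left (ha k) (abs_nonneg _)

lemma abs_poisAvg_le {x : ℝ} (hx : 0 ≤ x) {a : ℕ → ℝ} {B : ℝ} (ha : ∀ k, |a k| ≤ B) :
    |poisAvg x a| ≤ B := by
  have h := abs_poisAvg_le' x ha
  rwa [abs_of_nonneg hx, ← Real.exp_add, neg_add_cancel, Real.exp_zero, one_mul] at h

lemma poisAvg_tsum (x : ℝ) {a : ℕ → ℕ → ℝ} {b : ℕ → ℝ} (hb : Summable b)
    (ha : ∀ n k, |a n k| ≤ b n) :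
    poisAvg x (fun k => ∑' n, a n k) = ∑' n, poisAvg x (a n) := by
  simp only [poisAvg, ← tsum_mul_left]
  refine Summable.tsum_comm (f := fun n k => pois x k * a n k) ?_
  have hb0 : ∀ n, 0 ≤ b n := fun n => (abs_nonneg _).trans (ha n 0)
  refine Summable.of_norm_bounded
    (hb.mul_of_nonneg (hasSum_abs_pois x).summable hb0 fun _ => abs_nonneg _) fun ⟨n, k⟩ => ?_
  simp only [Function.uncurry_apply_pair, Real.norm_eq_abs, abs_mul]
  rw [mul_comm]
  exact mul_le_mul_of_nonneg_right (ha n k) (abs_nonneg _)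

/-- Differentiating a Poisson expectation in the mean gives the expected increment. -/
lemma hasDerivAt_poisAvg {a : ℕ → ℝ} {B : ℝ} (h0 : a 0 = 0)
    (ha : ∀ k, |a (k + 1) - a k| ≤ B) (x : ℝ) :
    HasDerivAt (fun y => poisAvg y a) (poisAvg x fun k => a (k + 1) - a k) x := by
  have hB : 0 ≤ B := (abs_nonneg _).trans (ha 0)
  have hgrow : ∀ k, |a k| ≤ B * 2 ^ k := by
    intro k
    induction k with
    | zero => simpa [h0] using hB
    | succ k ih =>
      have h1 : |a (k + 1)| ≤ |a (k + 1) - a k| + |a k| := by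
        simpa using abs_add_le (a (k + 1) - a k) (a k)
      have h2 : (1 : ℝ) ≤ 2 ^ k := one_le_pow₀ (by norm_num)
      have h3 := ha k
      rw [pow_succ]
      nlinarith
  set R : ℝ := |x| + 1
  let g' : ℕ → ℝ → ℝ := fun k y => k * y ^ (k - 1) / (k.factorial : ℝ) * a k
  have hg'0 : ∀ y, g' 0 y = 0 := fun y => by simp [g']
  have hg'succ : ∀ k y, g' (k + 1) y = y ^ k / (k.factorial : ℝ) * a (k + 1) := fun k y => by
    simp only [g', Nat.factorial_succ, Nat.cast_mul, Nat.add_sub_cancel]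
    field_simp
  have hsum : ∀ y : ℝ, Summable fun k : ℕ => y ^ k / (k.factorial : ℝ) * a k := by
    intro y
    refine Summable.of_norm_bounded ((Real.summable_pow_div_factorial (|y| * 2)).mul_right B)
      fun k => ?_
    rw [Real.norm_eq_abs, abs_mul, abs_div, abs_pow, Nat.abs_cast, mul_pow]
    calc |y| ^ k / (k.factorial : ℝ) * |a k| ≤ |y| ^ k / (k.factorial : ℝ) * (B * 2 ^ k) := by
          gcongr; exact hgrow k
      _ = |y| ^ k * 2 ^ k / (k.factorial : ℝ) * B := by ring
  have hu : Summable fun k : ℕ => k * R ^ (k - 1) / (k.factorial : ℝ) * (B * 2 ^ k) := by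
    rw [← summable_nat_add_iff 1]
    refine ((Real.summable_pow_div_factorial (R * 2)).mul_right (2 * B)).congr fun k => ?_
    rw [mul_pow, pow_succ 2 k, Nat.factorial_succ, Nat.cast_mul, Nat.add_sub_cancel]
    field_simp
  have hseries : HasDerivAt (fun y => ∑' k : ℕ, y ^ k / (k.factorial : ℝ) * a k)
      (∑' k, g' k x) x := by
    refine hasDerivAt_tsum_of_isPreconnected hu (g' := g') (t := Metric.ball 0 R) (y₀ := 0) Metric.isOpen_ball
      (convex_ball _ _).isPreconnected ?_ ?_ ?_ (hsum 0) ?_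
    · exact fun k y _ => ((hasDerivAt_pow k y).div_const _).mul_const _
    · intro k y hy
      have hy' : |y| ≤ R := by simpa using (mem_ball_zero_iff.mp hy).le
      simp only [g', Real.norm_eq_abs, abs_mul, abs_div, abs_pow, Nat.abs_cast]
      gcongr
      exact hgrow _
    · exact Metric.mem_ball_self (by positivity)
    · rw [mem_ball_zero_iff, Real.norm_eq_abs]; exact lt_add_one _
  have hsucc : Summable fun k : ℕ => x ^ k / (k.factorial : ℝ) * a (k + 1) := by
    have hd : Summable fun k : ℕ => x ^ k / (k.factorial : ℝ) * (a (k + 1) - a k) := by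
      refine Summable.of_norm_bounded ((Real.summable_pow_div_factorial |x|).mul_right B)
        fun k => ?_
      rw [Real.norm_eq_abs, abs_mul, abs_div, abs_pow, Nat.abs_cast]
      gcongr
      exact ha k
    exact (hd.add (hsum x)).congr fun k => by ring
  have hg'sum : ∑' k, g' k x = ∑' k : ℕ, x ^ k / (k.factorial : ℝ) * a (k + 1) := by
    have hs : Summable fun k => g' k x :=
      (summable_nat_add_iff 1).mp (hsucc.congr fun k => (hg'succ k x).symm)
    rw [hs.tsum_eq_zero_add, hg'0, zero_add]
    exact tsum_congr fun k => hg'succ k x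
  have hfactor : ∀ (y : ℝ) (b : ℕ → ℝ),
      poisAvg y b = Real.exp (-y) * ∑' k : ℕ, y ^ k / (k.factorial : ℝ) * b k := by
    intro y b
    rw [poisAvg, ← tsum_mul_left]
    exact tsum_congr fun k => by rw [pois]; ring
  have hexp : HasDerivAt (fun y : ℝ => Real.exp (-y)) (-Real.exp (-x)) x := by
    simpa using (hasDerivAt_neg x).exp
  simp only [hfactor, mul_sub]
  refine (hexp.mul hseries).congr_deriv ?_
  rw [hg'sum, hsucc.tsum_sub (hsum x)]
  ring

lemma avgIdx_const {N : ℕ} (hN : 0 < N) (p k : ℕ) (c : ℝ) : avgIdx N p k (fun _ => c) = c := by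
  have hN' : (N : ℝ) ≠ 0 := by positivity
  rw [avgIdx, Finset.sum_const, Finset.card_univ, Fintype.card_fun, Fintype.card_fun,
    Fintype.card_fin, Fintype.card_fin, Fintype.card_fin, nsmul_eq_mul, Nat.cast_pow, Nat.cast_pow,
    ← pow_mul, mul_comm k p, inv_mul_cancel_left₀ (pow_ne_zero _ hN')]

lemma avgIdx_sub (N p k : ℕ) (f g : (Fin p → Fin k → Fin N) → ℝ) :
    avgIdx N p k (fun im => f im - g im) = avgIdx N p k f - avgIdx N p k g := by
  simp only [avgIdx, Finset.sum_sub_distrib, mul_sub]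

lemma avgIdx_const_mul (N p k : ℕ) (c : ℝ) (f : (Fin p → Fin k → Fin N) → ℝ) :
    avgIdx N p k (fun im => c * f im) = c * avgIdx N p k f := by
  simp only [avgIdx, ← Finset.mul_sum]
  ring

lemma abs_avgIdx_le {N : ℕ} (hN : 0 < N) (p k : ℕ) {f : (Fin p → Fin k → Fin N) → ℝ} {B : ℝ}
    (hf : ∀ im, |f im| ≤ B) : |avgIdx N p k f| ≤ B := by
  calc |avgIdx N p k f| ≤ avgIdx N p k (fun _ => B) := by
        rw [avgIdx, avgIdx, abs_mul, abs_of_nonneg (by positivity)]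
        gcongr
        exact (Finset.abs_sum_le_sum_abs _ _).trans (Finset.sum_le_sum fun im _ => hf im)
    _ = B := avgIdx_const hN p k B

lemma avgIdx_tsum (N p k : ℕ) {f : ℕ → (Fin p → Fin k → Fin N) → ℝ}
    (hf : ∀ im, Summable fun n => f n im) :
    avgIdx N p k (fun im => ∑' n, f n im) = ∑' n, avgIdx N p k (f n) := by
  simp only [avgIdx]
  rw [← Summable.tsum_finsetSum fun im _ => hf im, tsum_mul_left]

/-- Adding a fresh interaction with site indices `j` in front of the index families `im`. -/
def consIdx {N p k : ℕ} (j : Fin p → Fin N) (im : Fin p → Fin k → Fin N) :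
    Fin p → Fin (k + 1) → Fin N :=
  fun l => Fin.cons (j l) (im l)

lemma avgIdx_succ (N p k : ℕ) (f : (Fin p → Fin (k + 1) → Fin N) → ℝ) :
    avgIdx N p (k + 1) f = avgIdx N p k (fun im =>
      ((N : ℝ) ^ p)⁻¹ * ∑ j : Fin p → Fin N, f (consIdx j im)) := by
  let e : ((Fin p → Fin N) × (Fin p → Fin k → Fin N)) ≃ (Fin p → Fin (k + 1) → Fin N) :=
    (Equiv.arrowProdEquivProdArrow (Fin p) (fun _ => Fin N) (fun _ => Fin k → Fin N)).symm.trans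
      (Equiv.piCongrRight fun _ => Fin.consEquiv fun _ => Fin N)
  have hsum : ∑ im, f im = ∑ im : Fin p → Fin k → Fin N, ∑ j : Fin p → Fin N, f (consIdx j im) := by
    rw [← e.sum_comp, Fintype.sum_prod_type_right]
    rfl
  rw [avgIdx, avgIdx, hsum, ← Finset.mul_sum, ← mul_assoc, ← mul_inv, ← pow_add, Nat.mul_succ]

lemma abs_spin (b : Bool) : |spin b| = 1 := by
  cases b <;> simp [spin]

/-- The product of the spins at the sites `j`, i.e. a single cavity interaction. -/
noncomputable def cavSpin {N q : ℕ} (j : Fin q → Fin N) (σ : Fin N → Bool) : ℝ :=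
  ∏ l : Fin q, spin (σ (j l))

lemma abs_cavSpin {N q : ℕ} (j : Fin q → Fin N) (σ : Fin N → Bool) : |cavSpin j σ| = 1 := by
  simp [cavSpin, Finset.abs_prod, abs_spin]

/-- The perturbed Boltzmann average of a single cavity interaction. -/
noncomputable def cavMag (β : ℝ) {N p k q k' : ℕ} (im : Fin p → Fin k → Fin N)
    (im' : Fin q → Fin k' → Fin N) (j : Fin q → Fin N) : ℝ :=
  (∑ σ : Fin N → Bool, cavSpin j σ * wpert β im im' σ) / Zpert β im im'

lemma Real.exp_mul_of_abs_eq_one (β : ℝ) {s : ℝ} (hs : |s| = 1) :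
    Real.exp (β * s) = Real.cosh β * (1 + Real.tanh β * s) := by
  have hc := (Real.cosh_pos β).ne'
  rw [Real.tanh_eq_sinh_div_cosh]
  rcases eq_or_eq_neg_of_abs_eq hs with rfl | rfl
  · rw [mul_one, ← Real.cosh_add_sinh]
    field_simp
  · rw [mul_neg_one, ← Real.cosh_sub_sinh]
    field_simp
    ring

lemma Real.hasSum_log_one_add_tanh_mul (β : ℝ) {m : ℝ} (hm : |m| ≤ 1) :
    HasSum (fun n : ℕ => (-1 : ℝ) ^ (n + 1) / ((n : ℝ) + 1) * Real.tanh β ^ (n + 1) * m ^ (n + 1))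
      (-Real.log (1 + Real.tanh β * m)) := by
  have h : |-(Real.tanh β * m)| < 1 := by
    rw [abs_neg, abs_mul]
    exact (mul_le_of_le_one_right (abs_nonneg _) hm).trans_lt (Real.abs_tanh_lt_one β)
  have hsum := Real.hasSum_pow_div_log_of_abs_lt_one h
  rw [sub_neg_eq_add] at hsum
  refine hsum.congr_fun fun n => ?_
  rw [neg_pow (Real.tanh β * m), mul_pow]
  ring

lemma abs_coeff_le (β : ℝ) (n : ℕ) :
    |(-1 : ℝ) ^ (n + 1) / ((n : ℝ) + 1) * Real.tanh β ^ (n + 1)| ≤ |Real.tanh β| ^ (n + 1) := by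
  rw [abs_mul, abs_div, abs_pow, abs_pow, abs_neg, abs_one, one_pow]
  refine mul_le_of_le_one_left (by positivity) ?_
  have hn : (0 : ℝ) ≤ n := n.cast_nonneg
  rw [abs_of_pos (by positivity)]
  exact (div_le_one (by positivity)).mpr (by linarith)

lemma summable_abs_tanh_pow (β : ℝ) : Summable fun n : ℕ => |Real.tanh β| ^ (n + 1) :=
  (summable_nat_add_iff 1).mpr
    (summable_geometric_of_lt_one (abs_nonneg _) (Real.abs_tanh_lt_one β))

section

variable (β : ℝ) {N p k q k' : ℕ} (im : Fin p → Fin k → Fin N) (im' : Fin q → Fin k' → Fin N)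

lemma Zpart_pos : 0 < Zpart β im :=
  Finset.sum_pos (fun _ _ => Real.exp_pos _) Finset.univ_nonempty

lemma Zpert_pos : 0 < Zpert β im im' :=
  Finset.sum_pos (fun _ _ => Real.exp_pos _) Finset.univ_nonempty

lemma Zpert_zero (im₀ : Fin q → Fin 0 → Fin N) : Zpert β im im₀ = Zpart β im := by
  simp [Zpert, wpert, Zpart, cavSum]

lemma abs_cavMag_le_one (j : Fin q → Fin N) : |cavMag β im im' j| ≤ 1 := by
  rw [cavMag, abs_div, abs_of_pos (Zpert_pos β im im'), div_le_one (Zpert_pos β im im')]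
  refine (Finset.abs_sum_le_sum_abs _ _).trans (Finset.sum_le_sum fun σ _ => ?_)
  rw [abs_mul, abs_cavSpin, one_mul, wpert, Real.abs_exp]

lemma wpert_consIdx (j : Fin q → Fin N) (σ : Fin N → Bool) :
    wpert β im (consIdx j im') σ = wpert β im im' σ * Real.exp (β * cavSpin j σ) := by
  rw [wpert, wpert, ← Real.exp_add]
  congr 1
  simp only [cavSum, cavSpin, consIdx, Fin.sum_univ_succ, Fin.cons_zero, Fin.cons_succ]
  ring

lemma Zpert_consIdx (j : Fin q → Fin N) :
    Zpert β im (consIdx j im') =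
      Zpert β im im' * (Real.cosh β * (1 + Real.tanh β * cavMag β im im' j)) := by
  have hZ := (Zpert_pos β im im').ne'
  have hmag : Zpert β im im' * cavMag β im im' j =
      ∑ σ : Fin N → Bool, cavSpin j σ * wpert β im im' σ := mul_div_cancel₀ _ hZ
  calc Zpert β im (consIdx j im')
      = ∑ σ : Fin N → Bool, (Real.cosh β * wpert β im im' σ +
          Real.cosh β * Real.tanh β * (cavSpin j σ * wpert β im im' σ)) :=
        Finset.sum_congr rfl fun σ _ => by
          rw [wpert_consIdx, Real.exp_mul_of_abs_eq_one β (abs_cavSpin j σ)]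
          ring
    _ = Real.cosh β * Zpert β im im' +
          Real.cosh β * Real.tanh β * (Zpert β im im' * cavMag β im im' j) := by
        rw [Finset.sum_add_distrib, ← Finset.mul_sum, ← Finset.mul_sum, hmag, Zpert]
    _ = _ := by ring

lemma hasSum_log_Zpert_consIdx (j : Fin q → Fin N) :
    HasSum (fun n : ℕ => (-1 : ℝ) ^ (n + 1) / ((n : ℝ) + 1) * Real.tanh β ^ (n + 1) *
        cavMag β im im' j ^ (n + 1))
      (Real.log (Real.cosh β) -
        (Real.log (Zpert β im (consIdx j im')) - Real.log (Zpert β im im'))) := by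
  have hm := abs_cavMag_le_one β im im' j
  have hpos : 0 < 1 + Real.tanh β * cavMag β im im' j := by
    have h : |Real.tanh β * cavMag β im im' j| < 1 := by
      rw [abs_mul]
      exact (mul_le_of_le_one_right (abs_nonneg _) hm).trans_lt (Real.abs_tanh_lt_one β)
    linarith [(abs_lt.mp h).1]
  convert Real.hasSum_log_one_add_tanh_mul β hm using 1
  rw [Zpert_consIdx, Real.log_mul (Zpert_pos β im im').ne'
    (mul_pos (Real.cosh_pos β) hpos).ne', Real.log_mul (Real.cosh_pos β).ne' hpos.ne']
  ring

lemma qOv_pow (n : ℕ) (σs : Fin n → Fin N → Bool) :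
    qOv N n σs ^ q = ((N : ℝ) ^ q)⁻¹ * ∑ j : Fin q → Fin N, ∏ a, cavSpin j (σs a) := by
  rw [qOv, mul_pow, inv_pow, Fintype.sum_pow]
  simp only [cavSpin]
  congr 1
  exact Finset.sum_congr rfl fun j _ => Finset.prod_comm

/-- Powers of the overlap are moments of the cavity magnetisation at a uniform random tuple. -/
lemma OmegaPert_qOv_pow (n : ℕ) :
    OmegaPert β im im' n (fun σs => qOv N n σs ^ q) =
      ((N : ℝ) ^ q)⁻¹ * ∑ j : Fin q → Fin N, cavMag β im im' j ^ n := by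
  simp only [OmegaPert, cavMag, div_pow, Fintype.sum_pow, qOv_pow, Finset.prod_mul_distrib]
  rw [← Finset.sum_div, ← mul_div_assoc, Finset.sum_comm, Finset.mul_sum]
  congr 1
  exact Finset.sum_congr rfl fun σs _ => by rw [← Finset.sum_mul, mul_assoc]

lemma card_inv_mul_sum_const (hN : 0 < N) (c : ℝ) :
    ((N : ℝ) ^ q)⁻¹ * ∑ _j : Fin q → Fin N, c = c := by
  have hN' : (N : ℝ) ≠ 0 := by positivity
  rw [Finset.sum_const, Finset.card_univ, Fintype.card_fun, Fintype.card_fin, Fintype.card_fin,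
    nsmul_eq_mul, Nat.cast_pow, inv_mul_cancel_left₀ (pow_ne_zero _ hN')]

lemma abs_OmegaPert_qOv_pow_le_one (hN : 0 < N) (n : ℕ) :
    |OmegaPert β im im' n (fun σs => qOv N n σs ^ q)| ≤ 1 := by
  rw [OmegaPert_qOv_pow, abs_mul, abs_of_nonneg (by positivity)]
  calc ((N : ℝ) ^ q)⁻¹ * |∑ j : Fin q → Fin N, cavMag β im im' j ^ n|
      ≤ ((N : ℝ) ^ q)⁻¹ * ∑ _j : Fin q → Fin N, (1 : ℝ) := by
        gcongr
        refine (Finset.abs_sum_le_sum_abs _ _).trans (Finset.sum_le_sum fun j _ => ?_)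
        rw [abs_pow]
        exact pow_le_one₀ (abs_nonneg _) (abs_cavMag_le_one β im im' j)
    _ = 1 := card_inv_mul_sum_const hN 1

/-- The expansion term of order `n + 1` of the cavity increment in powers of `tanh β`. -/
noncomputable def overlapTerm (n : ℕ) : ℝ :=
  (-1 : ℝ) ^ (n + 1) / ((n : ℝ) + 1) * Real.tanh β ^ (n + 1) *
    OmegaPert β im im' (n + 1) (fun σs => qOv N (n + 1) σs ^ q)

lemma abs_overlapTerm_le (hN : 0 < N) (n : ℕ) :
    |overlapTerm β im im' n| ≤ |Real.tanh β| ^ (n + 1) := by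
  rw [overlapTerm, abs_mul]
  exact (mul_le_of_le_one_right (abs_nonneg _)
    (abs_OmegaPert_qOv_pow_le_one β im im' hN (n + 1))).trans (abs_coeff_le β n)

/-- The mean effect on `log Z` of one extra uniform cavity interaction. -/
lemma avg_log_Zpert_consIdx (hN : 0 < N) :
    ((N : ℝ) ^ q)⁻¹ * ∑ j : Fin q → Fin N, Real.log (Zpert β im (consIdx j im') / Zpart β im) =
      Real.log (Zpert β im im' / Zpart β im) +
        (Real.log (Real.cosh β) - ∑' n, overlapTerm β im im' n) := by
  have h := (hasSum_sum fun j (_ : j ∈ Finset.univ) =>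
    hasSum_log_Zpert_consIdx β im im' j).mul_left ((N : ℝ) ^ q)⁻¹
  have h' : ∑' n, overlapTerm β im im' n = _ := (h.congr_fun fun n => by
    rw [overlapTerm, OmegaPert_qOv_pow, ← Finset.mul_sum]; ring).tsum_eq
  rw [h', Finset.sum_sub_distrib, Finset.sum_sub_distrib, mul_sub, mul_sub,
    card_inv_mul_sum_const hN, card_inv_mul_sum_const hN]
  simp only [Real.log_div (Zpert_pos β im _).ne' (Zpart_pos β im).ne', Finset.sum_sub_distrib,
    mul_sub, card_inv_mul_sum_const hN]
  ring

end

/-- The conditional quenched average of `log (Z_{N,t} / Z_N)` given `k'` cavity interactions. -/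
noncomputable def cavityLog (β : ℝ) {N p k : ℕ} (im : Fin p → Fin k → Fin N) (q k' : ℕ) : ℝ :=
  avgIdx N q k' fun im' => Real.log (Zpert β im im' / Zpart β im)

section

variable {β : ℝ} {N p k : ℕ} (im : Fin p → Fin k → Fin N)

lemma cavityLog_zero (hN : 0 < N) (q : ℕ) : cavityLog β im q 0 = 0 := by
  simp only [cavityLog, Zpert_zero, div_self (Zpart_pos β im).ne', Real.log_one, avgIdx_const hN]

lemma abs_tsum_overlapTerm_le (hN : 0 < N) {q k' : ℕ} (im' : Fin q → Fin k' → Fin N) :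
    |∑' n, overlapTerm β im im' n| ≤ ∑' n : ℕ, |Real.tanh β| ^ (n + 1) := by
  rw [← Real.norm_eq_abs]
  exact tsum_of_norm_bounded (summable_abs_tanh_pow β).hasSum (abs_overlapTerm_le β im im' hN)

lemma cavityLog_succ_sub (hN : 0 < N) (q k' : ℕ) :
    cavityLog β im q (k' + 1) - cavityLog β im q k' =
      Real.log (Real.cosh β) -
        avgIdx N q k' (fun im' => ∑' n, overlapTerm β im im' n) := by
  rw [cavityLog, cavityLog, avgIdx_succ, ← avgIdx_sub]
  simp only [avg_log_Zpert_consIdx β im _ hN, add_sub_cancel_left]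
  rw [avgIdx_sub, avgIdx_const hN]

lemma abs_cavityLog_succ_sub_le (hN : 0 < N) (q k' : ℕ) :
    |cavityLog β im q (k' + 1) - cavityLog β im q k'| ≤
      |Real.log (Real.cosh β)| + ∑' n : ℕ, |Real.tanh β| ^ (n + 1) := by
  rw [cavityLog_succ_sub im hN]
  exact (abs_sub _ _).trans
    (add_le_add_right (abs_avgIdx_le hN q k' fun im' => abs_tsum_overlapTerm_le im hN im') _)

end

lemma hasDerivAt_avgIdx {N p k : ℕ} {f : (Fin p → Fin k → Fin N) → ℝ → ℝ}
    {f' : (Fin p → Fin k → Fin N) → ℝ} {x : ℝ} (hf : ∀ im, HasDerivAt (f im) (f' im) x) :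
    HasDerivAt (fun y => avgIdx N p k fun im => f im y) (avgIdx N p k f') x :=
  (HasDerivAt.fun_sum fun im _ => hf im).const_mul _

/-- The derivative of the cavity function is the mean effect of one extra cavity interaction. -/
lemma hasDerivAt_cavityFn {N : ℕ} (hN : 0 < N) (p : ℕ) (γ β t : ℝ) :
    HasDerivAt (fun s => cavityFn N p γ β s)
      (2 * γ * EquenchCav N p γ t fun _ im _ im' =>
        Real.log (Real.cosh β) - ∑' n, overlapTerm β im im' n) t := by
  set B : ℝ := |Real.log (Real.cosh β)| + ∑' n : ℕ, |Real.tanh β| ^ (n + 1)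
  have hincr : ∀ {k : ℕ} (im : Fin p → Fin k → Fin N) (k' : ℕ),
      |cavityLog β im (p - 1) (k' + 1) - cavityLog β im (p - 1) k'| ≤ B :=
    fun im k' => abs_cavityLog_succ_sub_le im hN (p - 1) k'
  have hB : 0 ≤ B := by positivity
  let d : ∀ {k : ℕ}, (Fin p → Fin k → Fin N) → ℝ → ℝ := fun im s =>
    poisAvg (2 * γ * s) fun k' => cavityLog β im (p - 1) (k' + 1) - cavityLog β im (p - 1) k'
  have hd : ∀ {k : ℕ} (im : Fin p → Fin k → Fin N) (s : ℝ),
      HasDerivAt (fun s => poisAvg (2 * γ * s) (cavityLog β im (p - 1))) (2 * γ * d im s) s := by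
    intro k im s
    have h := (hasDerivAt_poisAvg (cavityLog_zero im hN (p - 1)) (hincr im) (2 * γ * s)).comp s
      ((hasDerivAt_id s).const_mul (2 * γ))
    rw [mul_one] at h
    exact h.congr_deriv (mul_comm _ _)
  set R : ℝ := |t| + 1
  have hbound : ∀ {k : ℕ} (im : Fin p → Fin k → Fin N), ∀ s ∈ Metric.ball (0 : ℝ) R,
      |2 * γ * d im s| ≤
        |2 * γ| * (Real.exp (|2 * γ| * R) * Real.exp (|2 * γ| * R) * B) := by
    intro k im s hs
    have hs' : |s| ≤ R := by simpa using (mem_ball_zero_iff.mp hs).le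
    have hx : |2 * γ * s| ≤ |2 * γ| * R := by rw [abs_mul]; gcongr
    rw [abs_mul]
    gcongr
    refine (abs_poisAvg_le' _ (hincr im)).trans ?_
    gcongr
    exact (neg_le_abs _).trans hx
  have hmain : HasDerivAt (fun s => ∑' k : ℕ, pois (γ * N) k * avgIdx N p k fun im =>
        poisAvg (2 * γ * s) (cavityLog β im (p - 1)))
      (∑' k : ℕ, pois (γ * N) k * avgIdx N p k fun im => 2 * γ * d im t) t := by
    refine hasDerivAt_tsum_of_isPreconnected
      (g' := fun k s => pois (γ * N) k * avgIdx N p k fun im => 2 * γ * d im s)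
      ((hasSum_abs_pois (γ * N)).summable.mul_right
        (|2 * γ| * (Real.exp (|2 * γ| * R) * Real.exp (|2 * γ| * R) * B)))
      (t := Metric.ball 0 R) (y₀ := 0) Metric.isOpen_ball (convex_ball _ _).isPreconnected
      (fun k s _ => (hasDerivAt_avgIdx fun im => hd im s).const_mul _) ?_ ?_ ?_ ?_
    · intro k s hs
      rw [Real.norm_eq_abs, abs_mul]
      exact mul_le_mul_of_nonneg_left
        (abs_avgIdx_le hN p k fun im => hbound im s hs) (abs_nonneg _)
    · exact Metric.mem_ball_self (by positivity)
    · have h0 : ∀ {k : ℕ} (im : Fin p → Fin k → Fin N),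
          poisAvg (2 * γ * 0) (cavityLog β im (p - 1)) = 0 := by
        intro k im
        refine (tsum_congr fun k' => ?_).trans tsum_zero
        rcases k' with _ | k'
        · rw [cavityLog_zero im hN, mul_zero]
        · simp [pois]
      simp only [h0, avgIdx_const hN]
      simpa only [mul_zero] using summable_zero
    · rw [mem_ball_zero_iff, Real.norm_eq_abs]; exact lt_add_one _
  refine hmain.congr_deriv ?_
  rw [EquenchCav, ← tsum_mul_left]
  refine tsum_congr fun k => ?_
  rw [avgIdx_const_mul, mul_left_comm]
  congr 3
  ext im
  exact tsum_congr fun k' => by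
    beta_reduce
    rw [cavityLog_succ_sub im hN, avgIdx_sub, avgIdx_const hN]

/-- A dominated series can be pulled out of the quenched expectation. -/
lemma EquenchCav_tsum {N : ℕ} (hN : 0 < N) (p : ℕ) {γ t : ℝ} (hγt : 0 ≤ 2 * γ * t)
    {f : ℕ → (k : ℕ) → (Fin p → Fin k → Fin N) →
      (k' : ℕ) → (Fin (p - 1) → Fin k' → Fin N) → ℝ} {b : ℕ → ℝ} (hb : Summable b)
    (hf : ∀ n k im k' im', |f n k im k' im'| ≤ b n) :
    EquenchCav N p γ t (fun k im k' im' => ∑' n, f n k im k' im') =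
      ∑' n, EquenchCav N p γ t (f n) := by
  have hin : ∀ n k im k', |avgIdx N (p - 1) k' (f n k im k')| ≤ b n := fun n k im k' =>
    abs_avgIdx_le hN _ _ (hf n k im k')
  have hpois : ∀ n k im, |poisAvg (2 * γ * t) fun k' => avgIdx N (p - 1) k' (f n k im k')| ≤ b n :=
    fun n k im => abs_poisAvg_le hγt (hin n k im)
  have hinner : ∀ k im, poisAvg (2 * γ * t) (fun k' => avgIdx N (p - 1) k' fun im' =>
      ∑' n, f n k im k' im') =
      ∑' n, poisAvg (2 * γ * t) fun k' => avgIdx N (p - 1) k' (f n k im k') := by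
    intro k im
    rw [← poisAvg_tsum _ hb fun n k' => hin n k im k']
    congr 1
    ext k'
    exact avgIdx_tsum _ _ _ fun im' => Summable.of_norm_bounded hb fun n => hf n k im k' im'
  change poisAvg (γ * N) (fun k => avgIdx N p k fun im => poisAvg (2 * γ * t) fun k' =>
    avgIdx N (p - 1) k' fun im' => ∑' n, f n k im k' im') = ∑' n, poisAvg (γ * N) fun k =>
      avgIdx N p k fun im => poisAvg (2 * γ * t) fun k' => avgIdx N (p - 1) k' (f n k im k')
  rw [← poisAvg_tsum _ hb fun n k => abs_avgIdx_le hN p k (hpois n k)]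
  congr 1
  ext k
  simp only [hinner]
  exact avgIdx_tsum _ _ _ fun im => Summable.of_norm_bounded hb fun n => hpois n k im

lemma EquenchCav_const_mul (N p : ℕ) (γ t c : ℝ) (f : (k : ℕ) → (Fin p → Fin k → Fin N) →
      (k' : ℕ) → (Fin (p - 1) → Fin k' → Fin N) → ℝ) :
    EquenchCav N p γ t (fun k im k' im' => c * f k im k' im') = c * EquenchCav N p γ t f := by
  have h : EquenchCav N p γ t (fun k im k' im' => c * f k im k' im') =
      poisAvg (γ * N) fun k => avgIdx N p k fun im => poisAvg (2 * γ * t) fun k' =>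
        avgIdx N (p - 1) k' fun im' => c * f k im k' im' := rfl
  simp only [h, avgIdx_const_mul, poisAvg_const_mul]
  rfl

lemma abs_EquenchCav_le {N : ℕ} (hN : 0 < N) (p : ℕ) {γ t : ℝ} (hγ : 0 ≤ γ) (ht : 0 ≤ t)
    {f : (k : ℕ) → (Fin p → Fin k → Fin N) →
      (k' : ℕ) → (Fin (p - 1) → Fin k' → Fin N) → ℝ} {B : ℝ}
    (hf : ∀ k im k' im', |f k im k' im'| ≤ B) : |EquenchCav N p γ t f| ≤ B :=
  abs_poisAvg_le (by positivity) fun k => abs_avgIdx_le hN p k fun im =>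
    abs_poisAvg_le (by positivity) fun k' => abs_avgIdx_le hN (p - 1) k' (hf k im k')

lemma EquenchCav_const_sub {N : ℕ} (hN : 0 < N) (p : ℕ) {γ t : ℝ} (hγt : 0 ≤ 2 * γ * t) (c : ℝ)
    {f : (k : ℕ) → (Fin p → Fin k → Fin N) →
      (k' : ℕ) → (Fin (p - 1) → Fin k' → Fin N) → ℝ} {B : ℝ}
    (hf : ∀ k im k' im', |f k im k' im'| ≤ B) :
    EquenchCav N p γ t (fun k im k' im' => c - f k im k' im') = c - EquenchCav N p γ t f := by
  have hin : ∀ k im k', |avgIdx N (p - 1) k' (f k im k')| ≤ B := fun k im k' =>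
    abs_avgIdx_le hN _ _ (hf k im k')
  have h : EquenchCav N p γ t (fun k im k' im' => c - f k im k' im') =
      poisAvg (γ * N) fun k => avgIdx N p k fun im => poisAvg (2 * γ * t) fun k' =>
        avgIdx N (p - 1) k' fun im' => c - f k im k' im' := rfl
  simp only [h, avgIdx_sub, avgIdx_const hN, poisAvg_const_sub _ c (hin _ _)]
  exact poisAvg_const_sub _ c fun k => abs_avgIdx_le hN p k fun im => abs_poisAvg_le hγt (hin k im)

/-- `t`-streaming of the `p`-spin cavity function (`γ = α^{p-1}`): for every `t ∈ [0,1]`,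
`∂_t Ψ_N(α,β,t) = 2α^{p-1} ln cosh β - 2α^{p-1} ∑_{n≥1} ((-1)^n/n) θ^n ⟨q_{1…n}^{p-1}⟩_{N,t}`,
with `θ = tanh β`, the series being absolutely convergent. -/
theorem pspin_cavity_t_derivative (p : ℕ) (hp : 2 ≤ p) (N : ℕ) (hN : 0 < N)
    (α β : ℝ) (hα : 0 < α) (hβ : 0 < β) (t : ℝ) (ht : t ∈ Set.Icc (0 : ℝ) 1) :
    Summable (fun n : ℕ =>
      |((-1 : ℝ) ^ (n + 1) / ((n : ℝ) + 1)) * Real.tanh β ^ (n + 1) *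
        qPowAvgPert N p (α ^ (p - 1)) β t (n + 1) (p - 1)|) ∧
    HasDerivAt (fun t' : ℝ => cavityFn N p (α ^ (p - 1)) β t')
      (2 * α ^ (p - 1) * Real.log (Real.cosh β) -
        2 * α ^ (p - 1) *
          ∑' n : ℕ, ((-1 : ℝ) ^ (n + 1) / ((n : ℝ) + 1)) * Real.tanh β ^ (n + 1) *
            qPowAvgPert N p (α ^ (p - 1)) β t (n + 1) (p - 1)) t := by
  have hγ : 0 ≤ α ^ (p - 1) := by positivity
  have hγt : 0 ≤ 2 * α ^ (p - 1) * t := mul_nonneg (by positivity) ht.1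
  have hterm : ∀ n : ℕ, ((-1 : ℝ) ^ (n + 1) / ((n : ℝ) + 1)) * Real.tanh β ^ (n + 1) *
      qPowAvgPert N p (α ^ (p - 1)) β t (n + 1) (p - 1) =
      EquenchCav N p (α ^ (p - 1)) t fun _ im _ im' => overlapTerm β im im' n := fun n =>
    (EquenchCav_const_mul N p _ t _ _).symm
  simp only [hterm]
  constructor
  · refine Summable.of_nonneg_of_le (fun _ => abs_nonneg _) (fun n => ?_) (summable_abs_tanh_pow β)
    exact abs_EquenchCav_le hN p hγ ht.1 fun _ im _ im' => abs_overlapTerm_le β im im' hN n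
  · refine (hasDerivAt_cavityFn hN p _ β t).congr_deriv ?_
    rw [EquenchCav_const_sub hN p hγt _ fun _ im _ im' => abs_tsum_overlapTerm_le im hN im',
      EquenchCav_tsum hN p hγt (f := fun n _ im _ im' => overlapTerm β im im' n)
        (summable_abs_tanh_pow β) fun n _ im _ im' => abs_overlapTerm_le β im im' hN n, mul_sub]
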